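/- Let r be a prime and n ≥ r. A block ((0,4),(−4,0)) occurs in a block diagonal form of the defining matrix J of M̄_q(n,r) if and only if r is odd and n = z·r for some even positive integer z; in that case there are exactly (r−1)/2 such blocks. -/

import Mathlib

open scoped BigOperators

/-- The `k × k` integer matrix `H_k = Σ_{1 ≤ j < i ≤ k} (E_{i,j} - E_{j,i})`. -/
def HmatZ (k : ℕ) : Matrix (Fin k) (Fin k) ℤ :=
  Matrix.of fun i j => if (j : ℕ) < (i : ℕ) then 1 else if (i : ℕ) < (j : ℕ) then -1 else 0

/-- The defining matrix `J` of the quasipolynomial algebra `M̄_q(n,r)`: the skew-symmetric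
`nr × nr` integer matrix of the linear map `A ↦ H_n A - A H_r` on `n × r` matrices in the
basis of matrix units, i.e. `J ((i,j),(s,t)) = (H_n)_{i,s} δ_{j,t} - δ_{i,s} (H_r)_{t,j}`. -/
def Jdef (n r : ℕ) : Matrix (Fin n × Fin r) (Fin n × Fin r) ℤ :=
  Matrix.of fun p q =>
    HmatZ n p.1 q.1 * (if p.2 = q.2 then 1 else 0) -
      (if p.1 = q.1 then 1 else 0) * HmatZ r q.2 p.2

/-- The `N × N` skew-symmetric block diagonal matrix with `2 × 2` blocks
`((0, d i), (-d i, 0))` for `i = 0, ..., p-1` (occupying the index pairs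
`(2i, 2i+1)`), and zeros elsewhere. -/
def blockSkew (N p : ℕ) (d : Fin p → ℤ) : Matrix (Fin N) (Fin N) ℤ :=
  Matrix.of fun a b =>
    if h : (a : ℕ) % 2 = 0 ∧ (b : ℕ) = (a : ℕ) + 1 ∧ (a : ℕ) / 2 < p then d ⟨(a : ℕ) / 2, h.2.2⟩
    else if h' : (b : ℕ) % 2 = 0 ∧ (a : ℕ) = (b : ℕ) + 1 ∧ (b : ℕ) / 2 < p then
      -d ⟨(b : ℕ) / 2, h'.2.2⟩
    else 0

/-- `blockSkew (n*r) p d` is a block diagonal form of the skew-symmetric matrix `J`: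
there is a matrix `U`, invertible over `ℤ`, with `U * J * Uᵀ = blockSkew (n*r) p d`,
where the `p` non-trivial blocks are `((0, d i), (-d i, 0))` with `d i ≥ 1`, followed by
a zero block. -/
def IsBlockForm (n r p : ℕ) (d : Fin p → ℤ) : Prop :=
  2 * p ≤ n * r ∧ (∀ i, 1 ≤ d i) ∧
    ∃ (U : Matrix (Fin (n * r)) (Fin n × Fin r) ℤ)
      (V : Matrix (Fin n × Fin r) (Fin (n * r)) ℤ),
      U * V = 1 ∧ V * U = 1 ∧ U * Jdef n r * U.transpose = blockSkew (n * r) p d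

/-- The corank `c_{n,r}` of the defining matrix `J` of `M̄_q(n,r)`:
`c_{n,r} = gcd(n,r)` if both `n/gcd(n,r)` and `r/gcd(n,r)` are odd, and `0` otherwise. -/
def corankJ (n r : ℕ) : ℕ :=
  if Odd (n / Nat.gcd n r) ∧ Odd (r / Nat.gcd n r) then Nat.gcd n r else 0

theorem blockSkew_cons_succ_succ (N p : ℕ) (m : ℤ) (d : Fin p → ℤ) (i j : Fin N) :
    blockSkew (N + 2) (p + 1) (Fin.cons m d) i.succ.succ j.succ.succ = blockSkew N p d i j := by
  have key : ∀ k : ℕ, (k + 1 + 1) / 2 = k / 2 + 1 := fun k => by omega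
  have hd : ∀ (k : ℕ) (h : (k + 1 + 1) / 2 < p + 1) (h' : k / 2 < p),
      (Fin.cons m d : Fin (p + 1) → ℤ) ⟨(k + 1 + 1) / 2, h⟩ = d ⟨k / 2, h'⟩ := by
    intro k h h'
    have : (⟨(k + 1 + 1) / 2, h⟩ : Fin (p + 1)) = Fin.succ ⟨k / 2, h'⟩ := by
      ext; simp [key]
    rw [this, Fin.cons_succ]
  simp only [blockSkew, Matrix.of_apply, Fin.val_succ]
  split_ifs <;> first | omega | rfl | (rw [hd])

theorem blockSkew_cons_zero_succ_succ (N p : ℕ) (d : Fin (p + 1) → ℤ) (j : Fin N) :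
    blockSkew (N + 2) (p + 1) d 0 j.succ.succ = 0 := by
  simp [blockSkew]

theorem blockSkew_cons_one_succ_succ (N p : ℕ) (d : Fin (p + 1) → ℤ) (j : Fin N) :
    blockSkew (N + 2) (p + 1) d (Fin.succ 0) j.succ.succ = 0 := by
  simp only [blockSkew, Matrix.of_apply, Fin.val_succ]
  rw [dif_neg (by simp), dif_neg (by simp)]

theorem blockSkew_antisymm (N p : ℕ) (d : Fin p → ℤ) (i j : Fin N) :
    blockSkew N p d i j = - blockSkew N p d j i := by
  simp only [blockSkew, Matrix.of_apply]
  split_ifs <;> omega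

theorem blockSkew_cons_zero_one (N p : ℕ) (m : ℤ) (d : Fin p → ℤ) :
    blockSkew (N + 2) (p + 1) (Fin.cons m d) 0 (Fin.succ 0) = m := by
  simp only [blockSkew, Matrix.of_apply]
  rw [dif_pos (by simp)]
  have : (⟨((0 : Fin (N + 2)) : ℕ) / 2, by simp⟩ : Fin (p + 1)) = 0 := by ext; simp
  rw [this, Fin.cons_zero]

theorem exists_basis_blockSkew (N : ℕ) : ∀ (M : Type) [AddCommGroup M] [Module.Free ℤ M]
    [Module.Finite ℤ M] (ω : M →ₗ[ℤ] M →ₗ[ℤ] ℤ), ω.IsAlt → Module.finrank ℤ M = N →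
    ∃ (p : ℕ) (d : Fin p → ℤ) (b : Module.Basis (Fin N) ℤ M), 2 * p ≤ N ∧ (∀ i, 1 ≤ d i) ∧
      ∀ i j, ω (b i) (b j) = blockSkew N p d i j := by
  induction N using Nat.strong_induction_on with
  | _ N ih =>
  intro M _ _ _ ω hω hN
  have hanti : ∀ u v, ω u v = - ω v u := fun u v => (hω.neg v u).symm
  by_cases h : ∃ m : ℕ, 0 < m ∧ ∃ e f, ω e f = m
  · classical
    obtain ⟨hm, e, f, hef⟩ := Nat.find_spec h
    have hmin := fun k hk => Nat.find_min (H := h) (m := k) hk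
    generalize Nat.find h = m at hm hef hmin
    have hm' : (0 : ℤ) < m := by exact_mod_cast hm
    have hdvd : ∀ x y, ω x y = m → ∀ v, (m : ℤ) ∣ ω x v := by
      intro x y hxy v
      by_contra hnd
      have h1 : ω x (v - (ω x v / m) • y) = ω x v % m := by
        rw [map_sub, map_smul, hxy, smul_eq_mul]
        linarith [Int.emod_add_mul_ediv (ω x v) m]
      have h2 : 0 ≤ ω x v % m := Int.emod_nonneg _ hm'.ne'
      have h3 : ω x v % m < m := Int.emod_lt_of_pos _ hm'
      have h4 : ω x v % m ≠ 0 := fun h0 => hnd (Int.dvd_of_emod_eq_zero h0)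
      refine hmin (ω x v % m).toNat (by omega) ⟨by omega, x, _, h1.trans (by omega)⟩
    have hfe : ω (-f) e = m := by rw [map_neg, LinearMap.neg_apply, ← hanti, hef]
    have hde := hdvd e f hef
    have hdf : ∀ v, (m : ℤ) ∣ ω f v := fun v => by
      simpa using hdvd (-f) e hfe v
    have hfe' : ω f e = -m := by rw [hanti, hef]
    let O : Submodule ℤ M := LinearMap.ker (ω f)
    let L : Submodule ℤ M := LinearMap.ker (ω e) ⊓ LinearMap.ker (ω f)
    have hLO : L ≤ O := inf_le_right
    obtain ⟨k, hk⟩ : ∃ k, Module.finrank ℤ L = k := ⟨_, rfl⟩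
    have hbas : ∀ c : Module.Basis (Fin k) ℤ L, ∃ b : Module.Basis (Fin (k + 2)) ℤ M,
        b 0 = e ∧ b (Fin.succ 0) = f ∧ ∀ i, b (Fin.succ (Fin.succ i)) = c i := by
      intro c
      obtain ⟨b1, hb1⟩ : ∃ b1 : Module.Basis (Fin (k + 1)) ℤ O,
          (b1 : Fin (k + 1) → O) = Fin.cons ⟨f, hω f⟩ (Submodule.inclusion hLO ∘ c) :=
        ⟨_, Module.Basis.coe_mkFinConsOfLE f (hω f) c hLO
          (by
            intro t x hx h0
            have h1 := congrArg (ω e) h0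
            have hx1 : ω e x = 0 := hx.1
            rw [map_add, map_smul, hef, hx1, map_zero, smul_eq_mul, add_zero] at h1
            exact (mul_eq_zero.1 h1).resolve_right hm'.ne')
          (by
            intro z hz
            obtain ⟨t, ht⟩ := hde z
            refine ⟨-t, ?_, ?_⟩
            · change ω e (z + (-t) • f) = 0
              rw [map_add, map_smul, hef, ht, smul_eq_mul]; ring
            · change ω f (z + (-t) • f) = 0
              have hz0 : ω f z = 0 := hz
              rw [map_add, map_smul, hz0, hω f]; simp)⟩
      let b2 : Module.Basis (Fin (k + 2)) ℤ M :=
        Module.Basis.mkFinCons e b1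
          (by
            intro t x hx h0
            have h1 := congrArg (ω f) h0
            have hx1 : ω f x = 0 := hx
            rw [map_add, map_smul, hfe', hx1, map_zero, smul_eq_mul, add_zero] at h1
            exact (mul_eq_zero.1 h1).resolve_right (by omega))
          (by
            intro z
            obtain ⟨t, ht⟩ := hdf z
            refine ⟨t, ?_⟩
            change ω f (z + t • e) = 0
            rw [map_add, map_smul, hfe', ht, smul_eq_mul]; ring)
      refine ⟨b2, ?_, ?_, fun i => ?_⟩
      · simp [b2]
      · simp only [b2, Module.Basis.coe_mkFinCons, Fin.cons_succ, Function.comp_apply, hb1,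
          Fin.cons_zero]
      · simp only [b2, Module.Basis.coe_mkFinCons, Fin.cons_succ, Function.comp_apply, hb1]
        rfl
    have hNk : N = k + 2 := by
      obtain ⟨b, -⟩ := hbas (Module.finBasisOfFinrankEq ℤ L hk)
      rw [← hN, Module.finrank_eq_card_basis b, Fintype.card_fin]
    subst hNk
    obtain ⟨p, d, c, hp, hd, hc⟩ := ih k (by omega) L
      ((ω.domRestrict₁₂ L L)) (fun x => hω x) hk
    obtain ⟨b, hb0, hb1, hb2⟩ := hbas c
    have hLe : ∀ i, ω e (c i) = 0 := fun i => (c i).2.1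
    have hLf : ∀ i, ω f (c i) = 0 := fun i => (c i).2.2
    refine ⟨p + 1, Fin.cons m d, b, by omega, ?_, ?_⟩
    · intro i
      refine Fin.cases ?_ (fun i => ?_) i
      · simp only [Fin.cons_zero]; omega
      · simp only [Fin.cons_succ]; exact hd i
    · have h01 : ω (b 0) (b (Fin.succ 0)) = blockSkew (k + 2) (p + 1) (Fin.cons m d) 0 (Fin.succ 0) := by
        rw [blockSkew_cons_zero_one, hb0, hb1, hef]
      have h0 : ∀ j : Fin k, ω (b 0) (b j.succ.succ) =
          blockSkew (k + 2) (p + 1) (Fin.cons m d) 0 j.succ.succ := fun j => by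
        rw [blockSkew_cons_zero_succ_succ, hb0, hb2, hLe]
      have h1 : ∀ j : Fin k, ω (b (Fin.succ 0)) (b j.succ.succ) =
          blockSkew (k + 2) (p + 1) (Fin.cons m d) (Fin.succ 0) j.succ.succ := fun j => by
        rw [blockSkew_cons_one_succ_succ, hb1, hb2, hLf]
      have hdiag : ∀ i, ω (b i) (b i) = blockSkew (k + 2) (p + 1) (Fin.cons m d) i i := fun i => by
        have := blockSkew_antisymm (k + 2) (p + 1) (Fin.cons m d) i i
        rw [hω (b i)]; omega
      have hsw : ∀ i j, ω (b i) (b j) = blockSkew (k + 2) (p + 1) (Fin.cons m d) i j →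
          ω (b j) (b i) = blockSkew (k + 2) (p + 1) (Fin.cons m d) j i := fun i j hij => by
        rw [hanti, hij, ← blockSkew_antisymm]
      intro i j
      refine Fin.cases ?_ (Fin.cases ?_ fun i => ?_) i <;>
        refine Fin.cases ?_ (Fin.cases ?_ fun j => ?_) j
      · exact hdiag _
      · exact h01
      · exact h0 j
      · exact hsw _ _ h01
      · exact hdiag _
      · exact h1 j
      · exact hsw _ _ (h0 i)
      · exact hsw _ _ (h1 i)
      · rw [blockSkew_cons_succ_succ, hb2, hb2, ← hc]; rfl
  · have hz : ∀ u v, ω u v = 0 := by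
      intro u v
      by_contra h0
      rcases lt_or_gt_of_ne h0 with h1 | h1
      · exact h ⟨(ω v u).toNat, by have := hanti u v; omega, v, u, by have := hanti u v; omega⟩
      · exact h ⟨(ω u v).toNat, by omega, u, v, by omega⟩
    refine ⟨0, Fin.elim0, Module.finBasisOfFinrankEq ℤ M hN, by omega, fun i => i.elim0, ?_⟩
    intro i j
    simp [blockSkew, hz]

theorem Jdef_transpose (n r : ℕ) : (Jdef n r).transpose = - Jdef n r := by
  ext p q
  simp only [Jdef, HmatZ, Matrix.transpose_apply, Matrix.neg_apply, Matrix.of_apply]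
  grind

theorem exists_isBlockForm (n r : ℕ) : ∃ (p : ℕ) (d : Fin p → ℤ), IsBlockForm n r p d := by
  have hanti : ∀ p q, Jdef n r p q = - Jdef n r q p := fun p q => by
    rw [← Matrix.neg_apply, ← Jdef_transpose, Matrix.transpose_apply]
  have halt : (Matrix.toLinearMap₂' ℤ (S₁ := ℤ) (S₂ := ℤ) (Jdef n r)).IsAlt := by
    intro v
    have : Matrix.toLinearMap₂' ℤ (S₁ := ℤ) (S₂ := ℤ) (Jdef n r) v v =
        -Matrix.toLinearMap₂' ℤ (S₁ := ℤ) (S₂ := ℤ) (Jdef n r) v v := by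
      conv_lhs => rw [Matrix.toLinearMap₂'_apply', Matrix.dotProduct_mulVec,
        ← Matrix.mulVec_transpose, Jdef_transpose, dotProduct_comm, Matrix.neg_mulVec,
        dotProduct_neg, ← Matrix.toLinearMap₂'_apply']
    omega
  obtain ⟨p, d, b, hp, hd, hb⟩ := exists_basis_blockSkew (n * r) (Fin n × Fin r → ℤ) _ halt
    (by simp)
  refine ⟨p, d, hp, hd, ((Pi.basisFun ℤ _).toMatrix b).transpose,
    (b.toMatrix (Pi.basisFun ℤ _)).transpose, ?_, ?_, ?_⟩
  · rw [← Matrix.transpose_mul, Module.Basis.toMatrix_mul_toMatrix_flip, Matrix.transpose_one]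
  · rw [← Matrix.transpose_mul, Module.Basis.toMatrix_mul_toMatrix_flip, Matrix.transpose_one]
  · ext i j
    rw [← hb, Matrix.toLinearMap₂'_apply', Matrix.transpose_transpose, Matrix.mul_assoc]
    rfl

/-- The `k × k` negacyclic shift matrix `P`, with `P e_i = e_{i+1}` and `P e_{k-1} = -e_0`. -/
def negShift (k : ℕ) : Matrix (Fin k) (Fin k) ℤ :=
  Matrix.of fun i j => if (i : ℕ) = j + 1 then 1 else if (i : ℕ) = 0 ∧ (j : ℕ) + 1 = k then -1 else 0

section negShift

variable {m : Type*} (n : ℕ)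

theorem negShift_mul_succ (B : Matrix (Fin (n + 1)) m ℤ) (i : Fin n) (j : m) :
    (negShift (n + 1) * B) i.succ j = B i.castSucc j := by
  rw [Matrix.mul_apply, Finset.sum_eq_single i.castSucc]
  · simp [negShift]
  · intro b _ hb
    have : (i : ℕ) ≠ b := fun h => hb (Fin.ext h.symm)
    simp [negShift, this]
  · simp

theorem negShift_mul_zero (B : Matrix (Fin (n + 1)) m ℤ) (j : m) :
    (negShift (n + 1) * B) 0 j = - B (Fin.last n) j := by
  rw [Matrix.mul_apply, Finset.sum_eq_single (Fin.last n)]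
  · simp [negShift]
  · intro b _ hb
    have : (b : ℕ) ≠ n := fun h => hb (Fin.ext h)
    simp [negShift, this]
  · simp

theorem mul_negShift_castSucc (B : Matrix m (Fin (n + 1)) ℤ) (i : m) (j : Fin n) :
    (B * negShift (n + 1)) i j.castSucc = B i j.succ := by
  rw [Matrix.mul_apply, Finset.sum_eq_single j.succ]
  · simp [negShift]
  · intro b _ hb
    have : (b : ℕ) ≠ j + 1 := fun h => hb (Fin.ext h)
    simp [negShift, this, j.2.ne]
  · simp

theorem mul_negShift_last (B : Matrix m (Fin (n + 1)) ℤ) (i : m) :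
    (B * negShift (n + 1)) i (Fin.last n) = - B i 0 := by
  rw [Matrix.mul_apply, Finset.sum_eq_single 0]
  · simp [negShift]
  · intro b _ hb
    have h1 : (b : ℕ) ≠ 0 := fun h => hb (Fin.ext h)
    have h2 : (b : ℕ) ≠ n + 1 := b.2.ne
    simp [negShift, h2, hb]
  · simp

end negShift

theorem negShift_pow_mul_apply (n : ℕ) {m : Type*} (B : Matrix (Fin (n + 1)) m ℤ) (j : m) (a : ℕ) :
    ∀ (k : ℕ) (h : a + k < n + 1), ((negShift (n + 1)) ^ k * B) ⟨a + k, h⟩ j = B ⟨a, by omega⟩ j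
  | 0, h => by simp
  | k + 1, h => by
    rw [pow_succ', Matrix.mul_assoc]
    exact (negShift_mul_succ n _ ⟨a + k, by omega⟩ j).trans (negShift_pow_mul_apply n B j a k _)

theorem negShift_pow_self (n : ℕ) : (negShift (n + 1)) ^ (n + 1) = -1 := by
  ext i j
  obtain ⟨i, hi⟩ := i
  have h1 : n + 1 = i + (1 + (n - i)) := by omega
  have h2 := negShift_pow_mul_apply n ((negShift (n + 1)) ^ (1 + (n - i))) j 0 i (by omega)
  have h3 := negShift_pow_mul_apply n (1 : Matrix (Fin (n + 1)) (Fin (n + 1)) ℤ) j i (n - i)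
    (by omega)
  rw [← pow_add, ← h1, Fin.mk_zero', pow_add _ 1, pow_one, negShift_mul_zero] at h2
  simp only [Nat.zero_add, Matrix.mul_one] at h2 h3
  have h4 : (⟨i + (n - i), by omega⟩ : Fin (n + 1)) = Fin.last n := by
    ext; simp; omega
  rw [h4] at h3
  rw [h2, h3, Matrix.neg_apply]

/-- The matrix `1 - P`, where `P` is the negacyclic shift. -/
def negShiftDiff (k : ℕ) : Matrix (Fin k) (Fin k) ℤ := 1 - negShift k

theorem negShiftDiff_mul_HmatZ (n : ℕ) :
    negShiftDiff (n + 1) * HmatZ (n + 1) = 1 + negShift (n + 1) := by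
  ext i j
  rw [negShiftDiff, sub_mul, one_mul, Matrix.sub_apply, Matrix.add_apply]
  refine Fin.cases ?_ (fun i => ?_) i
  · rw [negShift_mul_zero]
    have := j.2
    simp only [HmatZ, negShift, Matrix.of_apply, Matrix.one_apply, Fin.ext_iff, Fin.val_last,
      Fin.val_zero]
    grind
  · rw [negShift_mul_succ]
    simp only [HmatZ, negShift, Matrix.of_apply, Matrix.one_apply, Fin.ext_iff, Fin.val_succ,
      Fin.val_castSucc]
    grind

/-- The geometric sum of the negacyclic shift, a twofold inverse of `1 - P`. -/
def negShiftSum (n : ℕ) : Matrix (Fin n) (Fin n) ℤ := ∑ i ∈ Finset.range n, negShift n ^ i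

theorem negShiftDiff_mul_negShiftSum (n : ℕ) :
    negShiftDiff (n + 1) * negShiftSum (n + 1) = (2 : ℤ) • 1 := by
  rw [negShiftDiff, negShiftSum, mul_neg_geom_sum, negShift_pow_self, sub_neg_eq_add, two_smul]

theorem negShiftSum_mul_negShiftDiff (n : ℕ) :
    negShiftSum (n + 1) * negShiftDiff (n + 1) = (2 : ℤ) • 1 := by
  rw [negShiftDiff, negShiftSum, geom_sum_mul_neg, negShift_pow_self, sub_neg_eq_add, two_smul]

theorem two_smul_matrix_injective {m k : Type*} :
    Function.Injective fun A : Matrix m k ℤ => (2 : ℤ) • A := by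
  intro A B h
  ext i j
  simpa using congrFun (congrFun h i) j

theorem negShiftDiff_mul_inj {k : Type*} {n : ℕ} {A B : Matrix (Fin (n + 1)) k ℤ}
    (h : negShiftDiff (n + 1) * A = negShiftDiff (n + 1) * B) : A = B := by
  have h2 := congrArg (negShiftSum (n + 1) * ·) h
  simp only [← Matrix.mul_assoc, negShiftSum_mul_negShiftDiff, Matrix.smul_mul,
    Matrix.one_mul] at h2
  exact two_smul_matrix_injective h2

theorem mul_negShiftDiff_inj {k : Type*} {n : ℕ} {A B : Matrix k (Fin (n + 1)) ℤ}
    (h : A * negShiftDiff (n + 1) = B * negShiftDiff (n + 1)) : A = B := by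
  have h2 := congrArg (· * negShiftSum (n + 1)) h
  simp only [Matrix.mul_assoc, negShiftDiff_mul_negShiftSum, Matrix.mul_smul,
    Matrix.mul_one] at h2
  exact two_smul_matrix_injective h2

theorem HmatZ_mul_negShiftDiff (n : ℕ) :
    HmatZ (n + 1) * negShiftDiff (n + 1) = 1 + negShift (n + 1) := by
  have hH : HmatZ (n + 1) = negShiftSum (n + 1) - 1 := by
    apply negShiftDiff_mul_inj
    rw [negShiftDiff_mul_HmatZ, mul_sub, negShiftDiff_mul_negShiftSum, mul_one, two_smul,
      negShiftDiff]
    abel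
  rw [hH, sub_mul, negShiftSum_mul_negShiftDiff, one_mul, two_smul, negShiftDiff]
  abel

theorem negShiftDiff_mul_HmatZ_commutator_mul (n r : ℕ)
    (A : Matrix (Fin (n + 1)) (Fin (r + 1)) ℤ) :
    negShiftDiff (n + 1) * (HmatZ (n + 1) * A - A * HmatZ (r + 1)) * negShiftDiff (r + 1) =
      (2 : ℤ) • (negShift (n + 1) * A - A * negShift (r + 1)) := by
  have : negShiftDiff (n + 1) * (HmatZ (n + 1) * A - A * HmatZ (r + 1)) * negShiftDiff (r + 1) =
      (negShiftDiff (n + 1) * HmatZ (n + 1)) * (A * negShiftDiff (r + 1))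
       - (negShiftDiff (n + 1) * A) * (HmatZ (r + 1) * negShiftDiff (r + 1)) := by
    simp only [Matrix.mul_sub, Matrix.sub_mul, Matrix.mul_assoc]
  rw [this, negShiftDiff_mul_HmatZ, HmatZ_mul_negShiftDiff]
  simp only [negShiftDiff, Matrix.mul_sub, Matrix.sub_mul, Matrix.add_mul, Matrix.mul_add,
    Matrix.mul_one, Matrix.one_mul, two_smul, Matrix.mul_assoc]
  abel

theorem exists_HmatZ_commutator_eq_two_smul_iff (n r : ℕ)
    (C : Matrix (Fin (n + 1)) (Fin (r + 1)) ℤ) :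
    (∃ A : Matrix (Fin (n + 1)) (Fin (r + 1)) ℤ,
      HmatZ (n + 1) * A - A * HmatZ (r + 1) = (2 : ℤ) • C) ↔
      ∃ A : Matrix (Fin (n + 1)) (Fin (r + 1)) ℤ, negShift (n + 1) * A - A * negShift (r + 1) =
        negShiftDiff (n + 1) * C * negShiftDiff (r + 1) := by
  refine exists_congr fun A => ?_
  have hA := negShiftDiff_mul_HmatZ_commutator_mul n r A
  constructor
  · intro h
    rw [h, Matrix.mul_smul, Matrix.smul_mul] at hA
    exact (two_smul_matrix_injective hA).symm
  · intro h
    rw [h, ← Matrix.smul_mul, ← Matrix.mul_smul] at hA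
    exact negShiftDiff_mul_inj (mul_negShiftDiff_inj hA)

section cokernel

open Polynomial

/-- The linear map sending `E_{i,j}` to `X ^ (i + (r - 1 - j))`. -/
noncomputable def shiftPoly (n r : ℕ) : Matrix (Fin n) (Fin r) ℤ →ₗ[ℤ] ℤ[X] where
  toFun B := ∑ i, ∑ j, B i j • (X : ℤ[X]) ^ ((i : ℕ) + (j.rev : ℕ))
  map_add' A B := by simp [add_smul, Finset.sum_add_distrib]
  map_smul' c A := by simp [Finset.smul_sum, mul_assoc]

theorem shiftPoly_apply (n r : ℕ) (B : Matrix (Fin n) (Fin r) ℤ) :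
    shiftPoly n r B = ∑ i, ∑ j, B i j • (X : ℤ[X]) ^ ((i : ℕ) + (j.rev : ℕ)) := rfl

/-- The integer matrix unit `E_{i,j}`. -/
def matrixUnit {n r : ℕ} (i : Fin n) (j : Fin r) : Matrix (Fin n) (Fin r) ℤ := Matrix.single i j 1

theorem matrixUnit_apply {n r : ℕ} (i a : Fin n) (j b : Fin r) :
    matrixUnit i j a b = if i = a ∧ j = b then 1 else 0 := rfl

theorem shiftPoly_matrixUnit (n r : ℕ) (i : Fin n) (j : Fin r) :
    shiftPoly n r (matrixUnit i j) = X ^ ((i : ℕ) + (j.rev : ℕ)) := by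
  rw [shiftPoly_apply, Finset.sum_eq_single i, Finset.sum_eq_single j]
  · simp [matrixUnit_apply]
  · intro b _ hb
    simp [matrixUnit_apply, hb.symm]
  · simp
  · intro b _ hb
    simp [matrixUnit_apply, hb.symm]
  · simp

/-- The ideal `(X ^ n + 1, X ^ r + 1)` of `ℤ[X]`. -/
noncomputable def shiftIdeal (n r : ℕ) : Ideal ℤ[X] := Ideal.span {X ^ n + 1, X ^ r + 1}

theorem X_pow_left_add_one_mem (n r : ℕ) : X ^ n + 1 ∈ shiftIdeal n r :=
  Ideal.subset_span (by simp)

theorem X_pow_right_add_one_mem (n r : ℕ) : X ^ r + 1 ∈ shiftIdeal n r :=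
  Ideal.subset_span (by simp)

theorem X_mul_shiftPoly_sub_left_mem (n r : ℕ) (A : Matrix (Fin (n + 1)) (Fin r) ℤ) :
    X * shiftPoly _ _ A - shiftPoly _ _ (negShift (n + 1) * A) ∈ shiftIdeal (n + 1) r := by
  have : X * shiftPoly _ _ A - shiftPoly _ _ (negShift (n + 1) * A) =
      (∑ j, A (Fin.last n) j • (X : ℤ[X]) ^ (j.rev : ℕ)) * (X ^ (n + 1) + 1) := by
    rw [shiftPoly_apply, shiftPoly_apply, Fin.sum_univ_castSucc, Fin.sum_univ_succ]
    simp only [negShift_mul_succ, negShift_mul_zero, Fin.val_castSucc, Fin.val_succ, Fin.val_zero,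
      Fin.val_last, neg_smul, Finset.sum_neg_distrib, mul_add, Finset.mul_sum, Finset.sum_mul,
      Algebra.mul_smul_comm, Algebra.smul_mul_assoc, zero_add, mul_one]
    have h1 : ∀ (i : ℕ) (j : Fin r), (X : ℤ[X]) * X ^ (i + (j.rev : ℕ)) = X ^ (i + 1 + (j.rev : ℕ)) :=
      fun i j => by ring
    have h2 : ∀ j : Fin r, (X : ℤ[X]) ^ (j.rev : ℕ) * X ^ (n + 1) = X ^ (n + 1 + (j.rev : ℕ)) :=
      fun j => by ring
    simp only [h1, h2]
    abel
  rw [this]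
  exact Ideal.mul_mem_left _ _ (X_pow_left_add_one_mem _ _)

theorem X_mul_shiftPoly_sub_right_mem (n r : ℕ) (A : Matrix (Fin n) (Fin (r + 1)) ℤ) :
    X * shiftPoly _ _ A - shiftPoly _ _ (A * negShift (r + 1)) ∈ shiftIdeal n (r + 1) := by
  have : X * shiftPoly _ _ A - shiftPoly _ _ (A * negShift (r + 1)) =
      (∑ i, A i 0 • (X : ℤ[X]) ^ (i : ℕ)) * (X ^ (r + 1) + 1) := by
    rw [shiftPoly_apply, shiftPoly_apply, Finset.mul_sum, ← Finset.sum_sub_distrib, Finset.sum_mul]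
    refine Finset.sum_congr rfl fun i _ => ?_
    rw [Fin.sum_univ_succ, Fin.sum_univ_castSucc]
    simp only [mul_negShift_castSucc, mul_negShift_last, Fin.rev_succ, Fin.val_castSucc,
      Fin.rev_castSucc, Fin.val_succ, Fin.rev_zero, Fin.rev_last, Fin.val_zero,
      Fin.val_last, neg_smul, mul_add, Finset.mul_sum,
      Algebra.mul_smul_comm, Algebra.smul_mul_assoc, add_zero, mul_one]
    have h1 : ∀ k : ℕ, (X : ℤ[X]) * X ^ ((i : ℕ) + k) = X ^ ((i : ℕ) + (k + 1)) :=
      fun k => by ring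
    have h2 : (X : ℤ[X]) ^ (i : ℕ) * X ^ (r + 1) = X ^ ((i : ℕ) + (r + 1)) := by ring
    simp only [h1, h2]
    abel
  rw [this]
  exact Ideal.mul_mem_left _ _ (X_pow_right_add_one_mem _ _)

/-- The linear map `A ↦ P A - A P` for the negacyclic shifts `P`. -/
def shiftCommutator (n r : ℕ) : Matrix (Fin n) (Fin r) ℤ →ₗ[ℤ] Matrix (Fin n) (Fin r) ℤ where
  toFun A := negShift n * A - A * negShift r
  map_add' A B := by rw [Matrix.mul_add, Matrix.add_mul]; abel
  map_smul' c A := by simp [smul_sub]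

theorem shiftCommutator_apply (n r : ℕ) (A : Matrix (Fin n) (Fin r) ℤ) :
    shiftCommutator n r A = negShift n * A - A * negShift r := rfl

theorem aeval_mul_mem_range_shiftCommutator {n r : ℕ} (p : ℤ[X]) {B : Matrix (Fin n) (Fin r) ℤ}
    (hB : B ∈ LinearMap.range (shiftCommutator n r)) :
    aeval (negShift n) p * B ∈ LinearMap.range (shiftCommutator n r) := by
  obtain ⟨A, rfl⟩ := hB
  have hc : Commute (aeval (negShift n) p) (negShift n) := by
    have := (Commute.all p X).map (aeval (negShift n))
    rwa [aeval_X] at this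
  refine ⟨aeval (negShift n) p * A, ?_⟩
  rw [shiftCommutator_apply, shiftCommutator_apply, Matrix.mul_sub, ← Matrix.mul_assoc, ← hc.eq,
    Matrix.mul_assoc, Matrix.mul_assoc]

theorem sub_aeval_shiftPoly_mem_range (n r : ℕ) (B : Matrix (Fin (n + 1)) (Fin (r + 1)) ℤ) :
    B - aeval (negShift (n + 1)) (shiftPoly _ _ B) * matrixUnit (0 : Fin (n + 1)) (Fin.last r) ∈
      LinearMap.range (shiftCommutator (n + 1) (r + 1)) := by
  have hlast : ∀ i : Fin (n + 1), matrixUnit i (Fin.last r) =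
      negShift (n + 1) ^ (i : ℕ) * matrixUnit (0 : Fin (n + 1)) (Fin.last r) := by
    intro i
    induction i using Fin.induction with
    | zero => rw [Fin.val_zero, pow_zero, Matrix.one_mul]
    | succ i ih =>
      rw [Fin.val_succ, pow_succ', Matrix.mul_assoc, ← Fin.val_castSucc i, ← ih]
      ext a b
      refine Fin.cases ?_ (fun a => ?_) a
      · rw [negShift_mul_zero]
        simp [matrixUnit_apply, Fin.ext_iff, i.2.ne]
      · rw [negShift_mul_succ]
        simp [matrixUnit_apply]
  have hsingle : ∀ (i : Fin (n + 1)) (j : Fin (r + 1)), matrixUnit i j -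
      negShift (n + 1) ^ ((i : ℕ) + (j.rev : ℕ)) * matrixUnit (0 : Fin (n + 1)) (Fin.last r) ∈
      LinearMap.range (shiftCommutator (n + 1) (r + 1)) := by
    intro i j
    induction j using Fin.reverseInduction with
    | last => rw [hlast i]; simp
    | cast j ih =>
      have h1 : matrixUnit i j.castSucc =
          matrixUnit i j.succ * negShift (r + 1) := by
        ext a b
        refine Fin.lastCases ?_ (fun b => ?_) b
        · rw [mul_negShift_last]
          simp [matrixUnit_apply, Fin.ext_iff, j.2.ne]
        · rw [mul_negShift_castSucc]
          simp [matrixUnit_apply]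
      have h2 := aeval_mul_mem_range_shiftCommutator X ih
      have h3 := LinearMap.mem_range_self (shiftCommutator (n + 1) (r + 1))
        (matrixUnit i j.succ)
      have h4 := Submodule.sub_mem _ h2 h3
      rw [shiftCommutator_apply, aeval_X, ← h1] at h4
      convert h4 using 1
      rw [Fin.rev_castSucc, Fin.rev_succ, Fin.val_succ, Fin.val_castSucc, ← add_assoc, pow_succ',
        Matrix.mul_sub, Matrix.mul_assoc]
      abel
  induction B using Matrix.induction_on' with
  | h_zero => simp
  | h_add A B hA hB =>
    convert Submodule.add_mem _ hA hB using 1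
    rw [map_add, map_add, Matrix.add_mul]
    abel
  | h_std_basis i j x =>
    have h1 : Matrix.single i j x = x • matrixUnit i j := by
      rw [matrixUnit, Matrix.smul_single, smul_eq_mul, mul_one]
    rw [h1, map_smul, map_smul, Matrix.smul_mul, ← smul_sub, shiftPoly_matrixUnit, map_pow, aeval_X]
    exact Submodule.smul_mem _ x (hsingle i j)

theorem aeval_mul_single_mem_range (n r : ℕ) {p : ℤ[X]} (hp : p ∈ shiftIdeal (n + 1) (r + 1)) :
    aeval (negShift (n + 1)) p * matrixUnit (0 : Fin (n + 1)) (Fin.last r) ∈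
      LinearMap.range (shiftCommutator (n + 1) (r + 1)) := by
  obtain ⟨a, b, rfl⟩ := Ideal.mem_span_pair.1 hp
  generalize matrixUnit (0 : Fin (n + 1)) (Fin.last r) = E
  have h1 : ∀ k : ℕ, negShift (n + 1) ^ k * E - E * negShift (r + 1) ^ k ∈
      LinearMap.range (shiftCommutator (n + 1) (r + 1)) := by
    intro k
    induction k with
    | zero => rw [pow_zero, pow_zero, Matrix.one_mul, Matrix.mul_one, sub_self]; exact zero_mem _
    | succ k ih =>
      have h2 := aeval_mul_mem_range_shiftCommutator X ih
      have h3 := LinearMap.mem_range_self (shiftCommutator (n + 1) (r + 1))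
        (E * negShift (r + 1) ^ k)
      convert Submodule.add_mem _ h2 h3 using 1
      rw [shiftCommutator_apply, aeval_X, pow_succ', pow_succ, Matrix.mul_sub, Matrix.mul_assoc,
        Matrix.mul_assoc]
      abel
  have h2 := aeval_mul_mem_range_shiftCommutator b (h1 (r + 1))
  rw [negShift_pow_self] at h2
  convert h2 using 1
  simp only [map_add, map_mul, map_pow, aeval_X, map_one, negShift_pow_self, neg_add_cancel,
    mul_zero, zero_add, Matrix.mul_neg, Matrix.mul_one, sub_neg_eq_add, Matrix.mul_assoc]
  rw [Matrix.add_mul, Matrix.one_mul]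

theorem mem_range_shiftCommutator_iff (n r : ℕ) (B : Matrix (Fin (n + 1)) (Fin (r + 1)) ℤ) :
    B ∈ LinearMap.range (shiftCommutator (n + 1) (r + 1)) ↔
      shiftPoly _ _ B ∈ shiftIdeal (n + 1) (r + 1) := by
  constructor
  · rintro ⟨A, rfl⟩
    have := Ideal.sub_mem _ (X_mul_shiftPoly_sub_right_mem (n + 1) r A)
      (X_mul_shiftPoly_sub_left_mem n (r + 1) A)
    rwa [sub_sub_sub_cancel_left, ← map_sub] at this
  · intro h
    have := Submodule.add_mem _ (sub_aeval_shiftPoly_mem_range n r B)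
      (aeval_mul_single_mem_range n r h)
    rwa [sub_add_cancel] at this

theorem exists_Jdef_mulVec_eq_two_smul_iff {n r : ℕ} (hn : n ≠ 0) (hr : r ≠ 0)
    (c : Fin n × Fin r → ℤ) :
    (∃ a, (Jdef n r).mulVec a = (2 : ℤ) • c) ↔
      (1 - X) ^ 2 * shiftPoly n r (Matrix.of fun i j => c (i, j)) ∈ shiftIdeal n r := by
  obtain ⟨n, rfl⟩ := Nat.exists_eq_succ_of_ne_zero hn
  obtain ⟨r, rfl⟩ := Nat.exists_eq_succ_of_ne_zero hr
  set C : Matrix (Fin (n + 1)) (Fin (r + 1)) ℤ := Matrix.of fun i j => c (i, j)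
  have hJ : ∀ a : Fin (n + 1) × Fin (r + 1) → ℤ, ∀ i j, (Jdef (n + 1) (r + 1)).mulVec a (i, j) =
      (HmatZ (n + 1) * (Matrix.of fun i j => a (i, j)) -
        (Matrix.of fun i j => a (i, j)) * HmatZ (r + 1)) i j := by
    intro a i j
    simp only [Matrix.mulVec, dotProduct, Jdef, Matrix.of_apply, Matrix.sub_apply, Matrix.mul_apply,
      Fintype.sum_prod_type, sub_mul, Finset.sum_sub_distrib]
    congr 1
    · simp
    · simp [mul_comm]
  have h1 : (∃ a, (Jdef (n + 1) (r + 1)).mulVec a = (2 : ℤ) • c) ↔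
      ∃ A : Matrix (Fin (n + 1)) (Fin (r + 1)) ℤ,
        HmatZ (n + 1) * A - A * HmatZ (r + 1) = (2 : ℤ) • C := by
    constructor
    · rintro ⟨a, ha⟩
      refine ⟨Matrix.of fun i j => a (i, j), ?_⟩
      ext i j
      rw [← hJ, ha]
      rfl
    · rintro ⟨A, hA⟩
      refine ⟨fun p => A p.1 p.2, ?_⟩
      ext ⟨i, j⟩
      rw [hJ]
      exact congrFun (congrFun hA i) j
  rw [h1, exists_HmatZ_commutator_eq_two_smul_iff]
  change negShiftDiff (n + 1) * C * negShiftDiff (r + 1) ∈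
    LinearMap.range (shiftCommutator (n + 1) (r + 1)) ↔ _
  rw [mem_range_shiftCommutator_iff]
  have h2 := Ideal.mul_mem_left _ (1 - X) (X_mul_shiftPoly_sub_left_mem n (r + 1) C)
  have h3 := X_mul_shiftPoly_sub_right_mem (n + 1) r (negShiftDiff (n + 1) * C)
  have h4 : shiftPoly (n + 1) (r + 1) (negShiftDiff (n + 1) * C * negShiftDiff (r + 1)) -
      (1 - X) ^ 2 * shiftPoly (n + 1) (r + 1) C ∈ shiftIdeal (n + 1) (r + 1) := by
    convert Ideal.add_mem _ h2 h3 using 1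
    simp only [negShiftDiff, Matrix.mul_sub, Matrix.sub_mul, Matrix.one_mul, Matrix.mul_one,
      map_sub]
    ring
  exact ⟨fun h => by simpa using Ideal.sub_mem _ h h4, fun h => by simpa using Ideal.add_mem _ h h4⟩

end cokernel

section blockForm

theorem blockSkew_mulVec_even {N p : ℕ} (d : Fin p → ℤ) (a : Fin N → ℤ) (i : Fin p)
    (h : 2 * (i : ℕ) + 1 < N) :
    (blockSkew N p d).mulVec a ⟨2 * i, by omega⟩ = d i * a ⟨2 * i + 1, h⟩ := by
  rw [Matrix.mulVec, dotProduct, Finset.sum_eq_single ⟨2 * i + 1, h⟩]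
  · rw [blockSkew, Matrix.of_apply, dif_pos (by simp)]
    congr 3
    simp
  · intro b _ hb
    have : (b : ℕ) ≠ 2 * i + 1 := fun h => hb (Fin.ext h)
    rw [blockSkew, Matrix.of_apply, dif_neg (by simp [this]), dif_neg (by simp only; omega),
      zero_mul]
  · simp

theorem blockSkew_mulVec_odd {N p : ℕ} (d : Fin p → ℤ) (a : Fin N → ℤ) (i : Fin p)
    (h : 2 * (i : ℕ) + 1 < N) :
    (blockSkew N p d).mulVec a ⟨2 * i + 1, h⟩ = -(d i * a ⟨2 * i, by omega⟩) := by
  rw [Matrix.mulVec, dotProduct, Finset.sum_eq_single ⟨2 * i, by omega⟩]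
  · rw [blockSkew, Matrix.of_apply, dif_neg (by simp only; omega), dif_pos (by simp), neg_mul]
    congr 4
    simp
  · intro b _ hb
    have : (b : ℕ) ≠ 2 * i := fun h => hb (Fin.ext h)
    rw [blockSkew, Matrix.of_apply, dif_neg (by simp only; omega), dif_neg (by simp only; omega),
      zero_mul]
  · simp

theorem blockSkew_mulVec_of_le {N p : ℕ} (d : Fin p → ℤ) (a : Fin N → ℤ) (j : Fin N)
    (h : 2 * p ≤ j) : (blockSkew N p d).mulVec a j = 0 := by
  rw [Matrix.mulVec, dotProduct]
  refine Finset.sum_eq_zero fun b _ => ?_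
  rw [blockSkew, Matrix.of_apply, dif_neg (by omega), dif_neg (by omega), zero_mul]

theorem exists_blockSkew_mulVec_eq_iff {N p : ℕ} (hp : 2 * p ≤ N) (d : Fin p → ℤ)
    (w : Fin N → ℤ) :
    (∃ a, (blockSkew N p d).mulVec a = w) ↔
      (∀ i : Fin p, d i ∣ w ⟨2 * i, by omega⟩ ∧ d i ∣ w ⟨2 * i + 1, by omega⟩) ∧
        ∀ j : Fin N, 2 * p ≤ j → w j = 0 := by
  constructor
  · rintro ⟨a, rfl⟩
    refine ⟨fun i => ⟨?_, ?_⟩, fun j hj => blockSkew_mulVec_of_le d a j hj⟩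
    · rw [blockSkew_mulVec_even d a i (by omega)]
      exact dvd_mul_right _ _
    · rw [blockSkew_mulVec_odd d a i (by omega)]
      exact (dvd_mul_right _ _).neg_right
  · rintro ⟨h1, h2⟩
    choose s hs using fun i => (h1 i).1
    choose t ht using fun i => (h1 i).2
    refine ⟨fun j => if h : (j : ℕ) / 2 < p then
      if (j : ℕ) % 2 = 0 then - t ⟨j / 2, h⟩ else s ⟨j / 2, h⟩ else 0, ?_⟩
    ext j
    by_cases hj : 2 * p ≤ j
    · rw [blockSkew_mulVec_of_le _ _ _ hj, h2 j hj]
    · obtain ⟨j, hjN⟩ := j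
      simp only at hj
      rcases Nat.even_or_odd' j with ⟨i, rfl | rfl⟩
      · rw [blockSkew_mulVec_even d _ ⟨i, by omega⟩ (by simp only; omega), hs ⟨i, by omega⟩]
        have h3 : (2 * i + 1) / 2 = i := by omega
        have h4 : (2 * i + 1) % 2 ≠ 0 := by omega
        simp only [h3, h4, if_false]
        rw [dif_pos (by omega)]
      · rw [blockSkew_mulVec_odd d _ ⟨i, by omega⟩ (by simp only; omega), ht ⟨i, by omega⟩]
        have h3 : (2 * i) / 2 = i := by omega
        have h4 : (2 * i) % 2 = 0 := by omega
        simp only [h3, h4, if_true]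
        rw [dif_pos (by omega), mul_neg, neg_neg]

theorem exists_mulVec_eq_mulVec_iff {ι κ : Type*} [Fintype ι] [Fintype κ] [DecidableEq ι]
    [DecidableEq κ] {J : Matrix ι ι ℤ} {D : Matrix κ κ ℤ} {U : Matrix κ ι ℤ} {V : Matrix ι κ ℤ}
    (hUV : U * V = 1) (hVU : V * U = 1) (hD : U * J * U.transpose = D) (w : κ → ℤ) :
    (∃ a, J.mulVec a = V.mulVec w) ↔ ∃ a, D.mulVec a = w := by
  subst hD
  constructor
  · rintro ⟨a, ha⟩
    refine ⟨V.transpose.mulVec a, ?_⟩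
    rw [Matrix.mulVec_mulVec, Matrix.mul_assoc, ← Matrix.transpose_mul, hVU, Matrix.transpose_one,
      Matrix.mul_one, ← Matrix.mulVec_mulVec, ha, Matrix.mulVec_mulVec, hUV, Matrix.one_mulVec]
  · rintro ⟨a, rfl⟩
    refine ⟨U.transpose.mulVec a, ?_⟩
    rw [Matrix.mulVec_mulVec, Matrix.mulVec_mulVec, Matrix.mul_assoc, ← Matrix.mul_assoc V U, hVU,
      Matrix.one_mul]

/-- If every torsion element of the cokernel of `J` is killed by `2`, no block is `4`. -/
theorem IsBlockForm.ne_four {n r p : ℕ} {d : Fin p → ℤ} (h : IsBlockForm n r p d)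
    (htors : ∀ c : Fin n × Fin r → ℤ, (∃ a, (Jdef n r).mulVec a = (4 : ℤ) • c) →
      ∃ a, (Jdef n r).mulVec a = (2 : ℤ) • c) (i : Fin p) : d i ≠ 4 := by
  obtain ⟨hp, -, U, V, hUV, hVU, hD⟩ := h
  intro hi
  have hip : 2 * (i : ℕ) < n * r := by omega
  have h1 := htors (V.mulVec (Pi.single ⟨2 * i, hip⟩ 1))
  rw [← Matrix.mulVec_smul, ← Matrix.mulVec_smul, exists_mulVec_eq_mulVec_iff hUV hVU hD,
    exists_mulVec_eq_mulVec_iff hUV hVU hD, exists_blockSkew_mulVec_eq_iff hp,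
    exists_blockSkew_mulVec_eq_iff hp] at h1
  have h2 := ((h1 ?_).1 i).1
  · rw [hi] at h2
    simp at h2
  · refine ⟨fun k => ⟨?_, ?_⟩, fun j hj => ?_⟩
    · by_cases hk : k = i
      · subst hk; simp [hi]
      · have : (k : ℕ) ≠ i := fun h => hk (Fin.ext h)
        simp [this]
    · have : 2 * (k : ℕ) + 1 ≠ 2 * i := by omega
      simp [this]
    · have : (j : ℕ) ≠ 2 * i := by omega
      simp [Fin.ext_iff, this]

theorem IsBlockForm.dvd_four_and_full {n r p : ℕ} {d : Fin p → ℤ} (h : IsBlockForm n r p d)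
    (h4 : ∀ c : Fin n × Fin r → ℤ, ∃ a, (Jdef n r).mulVec a = (4 : ℤ) • c) :
    (∀ i, d i ∣ 4) ∧ 2 * p = n * r := by
  obtain ⟨hp, -, U, V, hUV, hVU, hD⟩ := h
  have h1 : ∀ w : Fin (n * r) → ℤ, ∃ a, (blockSkew (n * r) p d).mulVec a = (4 : ℤ) • w := by
    intro w
    rw [← exists_mulVec_eq_mulVec_iff hUV hVU hD, Matrix.mulVec_smul]
    exact h4 _
  have h2 := (exists_blockSkew_mulVec_eq_iff hp d _).1 (h1 fun _ => 1)
  refine ⟨fun i => by simpa using (h2.1 i).1, ?_⟩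
  by_contra hne
  have := h2.2 ⟨2 * p, by omega⟩ le_rfl
  simp at this

theorem IsBlockForm.card_filter_eq_four {n r p : ℕ} {d : Fin p → ℤ} (h : IsBlockForm n r p d)
    (h4 : ∀ c : Fin n × Fin r → ℤ, ∃ a, (Jdef n r).mulVec a = (4 : ℤ) • c)
    {A : Type*} [AddCommGroup A] (θ : (Fin n × Fin r → ℤ) →ₗ[ℤ] A) (hθ : Function.Surjective θ)
    (hker : ∀ c, θ c = 0 ↔ ∃ a, (Jdef n r).mulVec a = (2 : ℤ) • c) {k : ℕ}
    (hA : Nat.card A = 2 ^ k) :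
    2 * (Finset.univ.filter fun i : Fin p => d i = 4).card = k := by
  obtain ⟨hd4, hpN⟩ := h.dvd_four_and_full h4
  obtain ⟨hp, hd1, U, V, hUV, hVU, hD⟩ := h
  have hlt : ∀ x : {i // d i = 4} × Fin 2, 2 * (x.1.1 : ℕ) + (x.2 : ℕ) < n * r := fun x => by
    have := x.1.1.2; have := x.2.2; omega
  let χ : (Fin (n * r) → ℤ) →ₗ[ℤ] ({i // d i = 4} × Fin 2 → ZMod 2) :=
    { toFun := fun w x => (w ⟨_, hlt x⟩ : ZMod 2)
      map_add' := fun v w => by ext; simp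
      map_smul' := fun c w => by ext; simp }
  have hχ : Function.Surjective χ := by
    intro y
    refine ⟨fun j => if h : ∃ x, 2 * (x.1.1 : ℕ) + (x.2 : ℕ) = j then
      ((y h.choose).val : ℤ) else 0, ?_⟩
    ext x
    change ((dite _ _ _ : ℤ) : ZMod 2) = _
    have hx : ∃ x' : {i // d i = 4} × Fin 2,
      2 * (x'.1.1 : ℕ) + (x'.2 : ℕ) = 2 * (x.1.1 : ℕ) + (x.2 : ℕ) := ⟨x, rfl⟩
    rw [dif_pos hx]
    have hx' : hx.choose = x := by
      have := hx.choose_spec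
      have h1 := hx.choose.2.2
      have h2 := x.2.2
      ext <;> omega
    rw [hx']
    simp
  have hχker : ∀ w, χ w = 0 ↔ ∃ a, (blockSkew (n * r) p d).mulVec a = (2 : ℤ) • w := by
    intro w
    rw [exists_blockSkew_mulVec_eq_iff hp]
    have h42 : ∀ x : ℤ, (x : ZMod 2) = 0 ↔ (4 : ℤ) ∣ 2 * x := fun x => by
      rw [ZMod.intCast_zmod_eq_zero_iff_dvd x 2]
      push_cast
      omega
    constructor
    · intro hw
      refine ⟨fun i => ?_, fun j hj => absurd j.2 (by omega)⟩
      by_cases hi : d i = 4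
      · rw [hi]
        exact ⟨(h42 _).1 (congrFun hw (⟨i, hi⟩, 0)), (h42 _).1 (congrFun hw (⟨i, hi⟩, 1))⟩
      · have hd2 : d i ∣ 2 := by
          have h1 := hd4 i
          have h2 := hd1 i
          have h3 := Int.le_of_dvd (by norm_num) h1
          generalize d i = x at *
          interval_cases x <;> revert h1 <;> first | decide | omega
        exact ⟨hd2.mul_right _, hd2.mul_right _⟩
    · rintro ⟨hw, -⟩
      ext ⟨⟨i, hi⟩, b⟩
      have := hw i
      rw [hi] at this
      fin_cases b
      · exact (h42 _).2 this.1
      · exact (h42 _).2 this.2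
  let θ' : (Fin (n * r) → ℤ) →ₗ[ℤ] A := θ ∘ₗ V.mulVecLin
  have hθ' : Function.Surjective θ' := by
    refine hθ.comp fun c => ⟨U.mulVec c, ?_⟩
    rw [Matrix.mulVecLin_apply, Matrix.mulVec_mulVec, hVU, Matrix.one_mulVec]
  have hkereq : LinearMap.ker θ' = LinearMap.ker χ := by
    ext w
    rw [LinearMap.mem_ker, LinearMap.mem_ker, hχker, ← exists_mulVec_eq_mulVec_iff hUV hVU hD,
      Matrix.mulVec_smul, ← hker]
    rfl
  have e := (θ'.quotKerEquivOfSurjective hθ').symm.trans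
    ((Submodule.quotEquivOfEq _ _ hkereq).trans (χ.quotKerEquivOfSurjective hχ))
  have hc := Nat.card_congr e.toEquiv
  rw [hA, Nat.card_fun, Nat.card_prod, Nat.card_zmod, Nat.card_fin, Nat.card_eq_fintype_card,
    Fintype.card_subtype] at hc
  have := Nat.pow_right_injective le_rfl hc
  omega

end blockForm

section shiftIdeal

open Polynomial

theorem mem_span_singleton_of_smul_mem {g : ℤ[X]} (hg : g.Monic) {k : ℤ} (hk : k ≠ 0) {q : ℤ[X]}
    (h : k • q ∈ Ideal.span {g}) : q ∈ Ideal.span {g} := by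
  rw [Ideal.mem_span_singleton, ← modByMonic_eq_zero_iff_dvd hg] at h ⊢
  rw [smul_modByMonic] at h
  exact (smul_eq_zero.1 h).resolve_left hk

theorem shiftIdeal_of_odd_mul {z r : ℕ} (hz : Odd z) :
    shiftIdeal (z * r) r = Ideal.span {X ^ r + 1} := by
  apply le_antisymm
  · rw [shiftIdeal, Ideal.span_le]
    rintro x (rfl | rfl)
    · rw [SetLike.mem_coe, Ideal.mem_span_singleton, mul_comm, pow_mul]
      simpa using Odd.add_dvd_pow_add_pow ((X : ℤ[X]) ^ r) 1 hz
    · exact Ideal.subset_span rfl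
  · exact Ideal.span_mono (by simp)

theorem two_mem_shiftIdeal_of_even_mul {z r : ℕ} (hz : Even z) :
    (2 : ℤ[X]) ∈ shiftIdeal (z * r) r := by
  obtain ⟨m, rfl⟩ := hz
  have h1 : (X : ℤ[X]) ^ r + 1 ∣ X ^ ((m + m) * r) - 1 := by
    have h2 : ((X : ℤ[X]) ^ r) ^ 2 - 1 ∣ X ^ ((m + m) * r) - 1 := by
      have := sub_dvd_pow_sub_pow (((X : ℤ[X]) ^ r) ^ 2) 1 m
      rwa [one_pow, ← pow_mul, ← pow_mul, show r * 2 * m = (m + m) * r by ring, pow_mul] at this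
    exact Dvd.dvd.trans ⟨X ^ r - 1, by ring⟩ h2
  have h3 := Ideal.mem_of_dvd _ h1 (X_pow_right_add_one_mem ((m + m) * r) r)
  have h4 := Ideal.sub_mem _ (X_pow_left_add_one_mem ((m + m) * r) r) h3
  convert h4 using 1
  ring

theorem sq_one_sub_X_mem_of_even_mul_two {z : ℕ} (hz : Even z) :
    (1 - X) ^ 2 ∈ shiftIdeal (z * 2) 2 := by
  have := Ideal.sub_mem _ (X_pow_right_add_one_mem (z * 2) 2)
    (Ideal.mul_mem_left _ X (two_mem_shiftIdeal_of_even_mul hz))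
  convert this using 1
  ring

theorem pow_mul_two_eq_one {R : Type*} [Ring R] {x : R} {k : ℕ} (h : x ^ k = -1) :
    x ^ (k * 2) = 1 := by
  rw [pow_mul, h, neg_one_sq]

theorem mk_X_sq_eq_one {n r : ℕ} (h : n.Coprime r) :
    (Ideal.Quotient.mk (shiftIdeal n r) X) ^ 2 = 1 ∧
      (Ideal.Quotient.mk (shiftIdeal n r) X) ^ n = -1 ∧
      (Ideal.Quotient.mk (shiftIdeal n r) X) ^ r = -1 := by
  have h1 := Ideal.Quotient.eq_zero_iff_mem.2 (X_pow_left_add_one_mem n r)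
  have h2 := Ideal.Quotient.eq_zero_iff_mem.2 (X_pow_right_add_one_mem n r)
  rw [map_add, map_pow, map_one, add_eq_zero_iff_eq_neg] at h1 h2
  refine ⟨?_, h1, h2⟩
  have h3 : (Ideal.Quotient.mk (shiftIdeal n r) X) ^ (n * 2) = 1 := pow_mul_two_eq_one h1
  have h4 : (Ideal.Quotient.mk (shiftIdeal n r) X) ^ (r * 2) = 1 := pow_mul_two_eq_one h2
  have h5 := Nat.dvd_gcd (orderOf_dvd_of_pow_eq_one h3) (orderOf_dvd_of_pow_eq_one h4)
  rw [Nat.gcd_mul_right, h.gcd_eq_one, one_mul] at h5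
  exact orderOf_dvd_iff_pow_eq_one.1 h5

theorem pow_eq_self_of_odd {R : Type*} [Monoid R] {x : R} (hx : x ^ 2 = 1) {k : ℕ} (hk : Odd k) :
    x ^ k = x := by
  obtain ⟨m, rfl⟩ := hk
  rw [pow_succ, pow_mul, hx, one_pow, one_mul]

theorem pow_eq_one_of_even {R : Type*} [Monoid R] {x : R} (hx : x ^ 2 = 1) {k : ℕ}
    (hk : Even k) : x ^ k = 1 := by
  obtain ⟨m, rfl⟩ := hk
  rw [← two_mul, pow_mul, hx, one_pow]

theorem sq_one_sub_X_mem_of_coprime {n r : ℕ} (h : n.Coprime r)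
    (hpar : Odd n ∧ Even r ∨ Even n ∧ Odd r) : (1 - X) ^ 2 ∈ shiftIdeal n r := by
  obtain ⟨h1, h2, h3⟩ := mk_X_sq_eq_one h
  rw [← Ideal.Quotient.eq_zero_iff_mem, map_pow, map_sub, map_one]
  rcases hpar with ⟨hn, hr⟩ | ⟨hn, hr⟩
  · rw [pow_eq_self_of_odd h1 hn] at h2
    rw [pow_eq_one_of_even h1 hr] at h3
    rw [h2, ← h3, sub_self, zero_pow two_ne_zero]
  · rw [pow_eq_self_of_odd h1 hr] at h3
    rw [pow_eq_one_of_even h1 hn] at h2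
    rw [h3, ← h2, sub_self, zero_pow two_ne_zero]

theorem shiftIdeal_of_coprime_odd {n r : ℕ} (h : n.Coprime r) (hn : Odd n) (hr : Odd r) :
    shiftIdeal n r = Ideal.span {X + 1} := by
  apply le_antisymm
  · rw [shiftIdeal, Ideal.span_le]
    rintro x (rfl | rfl)
    · rw [SetLike.mem_coe, Ideal.mem_span_singleton]
      simpa using Odd.add_dvd_pow_add_pow (X : ℤ[X]) 1 hn
    · rw [SetLike.mem_coe, Ideal.mem_span_singleton]
      simpa using Odd.add_dvd_pow_add_pow (X : ℤ[X]) 1 hr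
  · rw [Ideal.span_singleton_le_iff_mem, ← Ideal.Quotient.eq_zero_iff_mem, map_add, map_one]
    obtain ⟨h1, h2, -⟩ := mk_X_sq_eq_one h
    rw [pow_eq_self_of_odd h1 hn] at h2
    rw [h2, neg_add_cancel]

theorem mem_shiftIdeal_of_smul_mem {n r : ℕ} (hr : r.Prime) (hn : n ≠ 0)
    (hnot : ¬ (Odd r ∧ ∃ z : ℕ, 0 < z ∧ Even z ∧ n = z * r)) {k : ℤ} (hk : k ≠ 0) {q : ℤ[X]}
    (h : k • ((1 - X) ^ 2 * q) ∈ shiftIdeal n r) : (1 - X) ^ 2 * q ∈ shiftIdeal n r := by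
  by_cases hdvd : r ∣ n
  · obtain ⟨z, rfl⟩ := hdvd
    rw [mul_comm r z] at *
    rcases Nat.even_or_odd z with hz | hz
    · have hr2 : r = 2 := hr.eq_two_or_odd'.resolve_right fun hodd =>
        hnot ⟨hodd, z, Nat.pos_of_ne_zero (left_ne_zero_of_mul hn), hz, rfl⟩
      subst hr2
      exact Ideal.mul_mem_right _ _ (sq_one_sub_X_mem_of_even_mul_two hz)
    · rw [shiftIdeal_of_odd_mul hz] at h ⊢
      refine mem_span_singleton_of_smul_mem ?_ hk h
      simpa using monic_X_pow_add_C (1 : ℤ) hr.ne_zero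
  · have hc : n.Coprime r := ((Nat.Prime.coprime_iff_not_dvd hr).2 hdvd).symm
    by_cases hpar : Odd n ∧ Odd r
    · rw [shiftIdeal_of_coprime_odd hc hpar.1 hpar.2] at h ⊢
      refine mem_span_singleton_of_smul_mem ?_ hk h
      simpa using monic_X_add_C (1 : ℤ)
    · refine Ideal.mul_mem_right _ _ (sq_one_sub_X_mem_of_coprime hc ?_)
      rcases hr.eq_two_or_odd' with rfl | hodd
      · exact Or.inl ⟨Nat.not_even_iff_odd.1 fun he => hdvd he.two_dvd, even_two⟩
      · exact Or.inr ⟨Nat.not_odd_iff_even.1 fun ho => hpar ⟨ho, hodd⟩, hodd⟩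

theorem sq_one_sub_X_mul_mem_iff_cyclotomic_dvd {z r : ℕ} (hr : r.Prime) (hodd : Odd r)
    (hz : Even z) (q : ℤ[X]) :
    (1 - X) ^ 2 * q ∈ shiftIdeal (z * r) r ↔
      cyclotomic r (ZMod 2) ∣ q.map (Int.castRingHom (ZMod 2)) := by
  have : Fact r.Prime := ⟨hr⟩
  have hmul := cyclotomic_prime_mul_X_sub_one (ZMod 2) r
  have hmulZ := cyclotomic_prime_mul_X_sub_one ℤ r
  constructor
  · intro h
    obtain ⟨a, b, hab⟩ := Ideal.mem_span_pair.1 h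
    have h1 : (X : (ZMod 2)[X]) ^ r - 1 ∣ (1 - X) ^ 2 * q.map (Int.castRingHom (ZMod 2)) := by
      have h2 := congrArg (Polynomial.map (Int.castRingHom (ZMod 2))) hab
      simp only [Polynomial.map_add, Polynomial.map_mul, Polynomial.map_pow, Polynomial.map_sub,
        map_X, Polynomial.map_one] at h2
      rw [← h2, ← CharTwo.sub_eq_add (X ^ (z * r)) 1, ← CharTwo.sub_eq_add (X ^ r) 1]
      refine dvd_add (Dvd.dvd.mul_left ?_ _) (dvd_mul_left _ _)
      rw [mul_comm z r, pow_mul]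
      simpa using sub_dvd_pow_sub_pow ((X : (ZMod 2)[X]) ^ r) 1 z
    have hX : (X - 1 : (ZMod 2)[X]) ≠ 0 := X_sub_C_ne_zero (1 : ZMod 2)
    have h3 : cyclotomic r (ZMod 2) ∣ (X - 1) * q.map (Int.castRingHom (ZMod 2)) := by
      rw [← mul_dvd_mul_iff_right hX, hmul]
      convert h1 using 1
      ring
    have h4 : IsCoprime (cyclotomic r (ZMod 2)) (X - 1) := by
      obtain ⟨t, ht⟩ := X_sub_C_dvd_sub_C_eval (p := cyclotomic r (ZMod 2)) (a := 1)
      have h5 : ((r : ℕ) : ZMod 2) = 1 := ZMod.natCast_eq_one_iff_odd.2 hodd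
      rw [eval_one_cyclotomic_prime, h5, C_1] at ht
      exact ⟨1, -t, by linear_combination ht⟩
    exact h4.dvd_of_dvd_mul_left h3
  · rintro ⟨t, ht⟩
    obtain ⟨t, rfl⟩ := Polynomial.map_surjective (Int.castRingHom (ZMod 2))
      (ZMod.intCast_surjective) t
    have h2 : (C 2 : ℤ[X]) ∣ q - cyclotomic r ℤ * t := by
      rw [C_dvd_iff_dvd_coeff]
      intro i
      have h3 : (q - cyclotomic r ℤ * t).map (Int.castRingHom (ZMod 2)) = 0 := by
        rw [Polynomial.map_sub, Polynomial.map_mul, map_cyclotomic, ht, sub_self]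
      have h4 := congrArg (fun f => coeff f i) h3
      simp only [coeff_map, coeff_zero, eq_intCast] at h4
      exact (ZMod.intCast_zmod_eq_zero_iff_dvd _ 2).1 h4
    obtain ⟨s, hs⟩ := h2
    have hq : (1 - X) ^ 2 * q = (X - 1) * t * (X ^ r + 1) +
        ((1 - X) ^ 2 * s - (X - 1) * t) * 2 := by
      rw [sub_eq_iff_eq_add] at hs
      rw [hs, show (C 2 : ℤ[X]) = 2 from rfl]
      linear_combination ((X - 1) * t) * hmulZ
    rw [hq]
    exact Ideal.add_mem _ (Ideal.mul_mem_left _ _ (X_pow_right_add_one_mem _ _))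
      (Ideal.mul_mem_left _ _ (two_mem_shiftIdeal_of_even_mul hz))

end shiftIdeal

section main

open Polynomial

theorem IsBlockForm.ne_four_of_not {n r p : ℕ} {d : Fin p → ℤ} (hr : r.Prime) (hn : n ≠ 0)
    (hnot : ¬ (Odd r ∧ ∃ z : ℕ, 0 < z ∧ Even z ∧ n = z * r)) (h : IsBlockForm n r p d)
    (i : Fin p) : d i ≠ 4 := by
  refine h.ne_four (fun c hc => ?_) i
  have h1 : ∃ a, (Jdef n r).mulVec a = (2 : ℤ) • ((4 : ℤ) • c) := by
    obtain ⟨a, ha⟩ := hc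
    exact ⟨(2 : ℤ) • a, by rw [Matrix.mulVec_smul, ha]⟩
  rw [exists_Jdef_mulVec_eq_two_smul_iff hn hr.ne_zero] at h1 ⊢
  refine mem_shiftIdeal_of_smul_mem hr hn hnot (k := 4) (by norm_num) ?_
  rw [← mul_smul_comm, ← map_smul]
  exact h1

/-- The reduction of `shiftPoly` in `𝔽₂[X] / Φ_r`. -/
noncomputable def shiftPolyModTwo (n r : ℕ) :
    (Fin n × Fin r → ℤ) →ₗ[ℤ] AdjoinRoot (cyclotomic r (ZMod 2)) :=
  ((AdjoinRoot.mk (cyclotomic r (ZMod 2))).comp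
    (mapRingHom (Int.castRingHom (ZMod 2)))).toAddMonoidHom.toIntLinearMap ∘ₗ shiftPoly n r ∘ₗ
      (LinearEquiv.curry ℤ ℤ (Fin n) (Fin r)).toLinearMap

theorem shiftPolyModTwo_apply (n r : ℕ) (c : Fin n × Fin r → ℤ) :
    shiftPolyModTwo n r c = AdjoinRoot.mk (cyclotomic r (ZMod 2))
      ((shiftPoly n r (Matrix.of fun i j => c (i, j))).map (Int.castRingHom (ZMod 2))) := rfl

theorem shiftPolyModTwo_surjective {n r : ℕ} (hn : n ≠ 0) (hr : r.Prime) :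
    Function.Surjective (shiftPolyModTwo n r) := by
  obtain ⟨n, rfl⟩ := Nat.exists_eq_succ_of_ne_zero hn
  have hmonic := cyclotomic.monic r (ZMod 2)
  intro y
  obtain ⟨g, rfl⟩ := AdjoinRoot.mk_surjective y
  have hdeg : (g %ₘ cyclotomic r (ZMod 2)).natDegree < r := by
    have h1 := natDegree_modByMonic_le g hmonic
    rw [natDegree_cyclotomic, Nat.totient_prime hr] at h1
    have := hr.two_le
    omega
  have hg : AdjoinRoot.mk (cyclotomic r (ZMod 2)) g =
      AdjoinRoot.mk (cyclotomic r (ZMod 2)) (g %ₘ cyclotomic r (ZMod 2)) := by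
    rw [AdjoinRoot.mk_eq_mk, modByMonic_eq_sub_mul_div, sub_sub_cancel]
    exact dvd_mul_right _ _
  rw [hg]
  generalize g %ₘ cyclotomic r (ZMod 2) = f at hdeg
  refine ⟨fun x => if x.1 = 0 then ((f.coeff (x.2.rev : ℕ)).val : ℤ) else 0, ?_⟩
  rw [shiftPolyModTwo_apply]
  congr 1
  rw [shiftPoly_apply, Fin.sum_univ_succ]
  simp only [Matrix.of_apply, Fin.succ_ne_zero, if_true, if_false, zero_smul,
    Finset.sum_const_zero, add_zero, Fin.val_zero, zero_add]
  rw [Polynomial.map_sum]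
  refine (Equiv.sum_comp Fin.revPerm (fun j : Fin r =>
    (((f.coeff (j : ℕ)).val : ℤ) • (X : ℤ[X]) ^ (j : ℕ)).map (Int.castRingHom (ZMod 2)))).trans ?_
  conv_rhs => rw [f.as_sum_range' r hdeg, ← Fin.sum_univ_eq_sum_range]
  refine Finset.sum_congr rfl fun j _ => ?_
  have hcast : (((f.coeff (j : ℕ)).cast : ℤ[X])).map (Int.castRingHom (ZMod 2)) =
      C (f.coeff (j : ℕ)) := by
    rw [← ZMod.natCast_val, Polynomial.map_natCast, ← C_eq_natCast, ZMod.natCast_zmod_val]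
  simp [← C_mul_X_pow_eq_monomial, hcast]

theorem natCard_adjoinRoot_cyclotomic {r : ℕ} (hr : r.Prime) :
    Nat.card (AdjoinRoot (cyclotomic r (ZMod 2))) = 2 ^ (r - 1) := by
  have hmonic := cyclotomic.monic r (ZMod 2)
  have := hmonic.finite_adjoinRoot
  have := hmonic.free_adjoinRoot
  rw [Module.natCard_eq_pow_finrank (K := ZMod 2), Nat.card_zmod,
    (AdjoinRoot.powerBasis' hmonic).finrank, AdjoinRoot.powerBasis'_dim, natDegree_cyclotomic,
    Nat.totient_prime hr]

theorem IsBlockForm.card_filter_eq_four_of_even {z r p : ℕ} {d : Fin p → ℤ} (hr : r.Prime)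
    (hodd : Odd r) (hz0 : 0 < z) (hz : Even z) (h : IsBlockForm (z * r) r p d) :
    (Finset.univ.filter fun i : Fin p => d i = 4).card = (r - 1) / 2 := by
  have hn : z * r ≠ 0 := mul_ne_zero hz0.ne' hr.ne_zero
  have := h.card_filter_eq_four (fun c => ?_) (shiftPolyModTwo _ _)
    (shiftPolyModTwo_surjective hn hr) (fun c => ?_) (natCard_adjoinRoot_cyclotomic hr)
  · omega
  · have h4 : (4 : ℤ) • c = (2 : ℤ) • ((2 : ℤ) • c) := by rw [smul_smul]; norm_num
    have h2 : (Matrix.of fun i j => ((2 : ℤ) • c) (i, j) : Matrix (Fin (z * r)) (Fin r) ℤ) =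
      (2 : ℤ) • Matrix.of fun i j => c (i, j) := rfl
    rw [h4, exists_Jdef_mulVec_eq_two_smul_iff hn hr.ne_zero, h2, map_smul, mul_smul_comm,
      zsmul_eq_mul]
    exact Ideal.mul_mem_right _ _ (two_mem_shiftIdeal_of_even_mul hz)
  · rw [exists_Jdef_mulVec_eq_two_smul_iff hn hr.ne_zero,
      sq_one_sub_X_mul_mem_iff_cyclotomic_dvd hr hodd hz, shiftPolyModTwo_apply,
      AdjoinRoot.mk_eq_zero]

end main

/-- Let `r` be a prime and `n ≥ r`.  A block `((0,4),(-4,0))` occurs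
in a block diagonal form of the defining matrix `J` of `M̄_q(n,r)` iff `r` is odd and
`n = z·r` for some even positive integer `z`; in that case every block diagonal form has
exactly `(r-1)/2` such blocks. -/
theorem Jdef_four_blocks
    (n r : ℕ) (hr : Nat.Prime r) (hrn : r ≤ n) :
    ((∃ (p : ℕ) (d : Fin p → ℤ), IsBlockForm n r p d ∧ ∃ i : Fin p, d i = 4) ↔
        (Odd r ∧ ∃ z : ℕ, 0 < z ∧ Even z ∧ n = z * r)) ∧
      ((Odd r ∧ ∃ z : ℕ, 0 < z ∧ Even z ∧ n = z * r) →
        ∀ (p : ℕ) (d : Fin p → ℤ), IsBlockForm n r p d →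
          (Finset.univ.filter fun i : Fin p => d i = 4).card = (r - 1) / 2) := by
  have hn : n ≠ 0 := (hr.pos.trans_le hrn).ne'
  have hcount : (Odd r ∧ ∃ z : ℕ, 0 < z ∧ Even z ∧ n = z * r) →
      ∀ (p : ℕ) (d : Fin p → ℤ), IsBlockForm n r p d →
        (Finset.univ.filter fun i : Fin p => d i = 4).card = (r - 1) / 2 := by
    rintro ⟨hodd, z, hz0, hz, rfl⟩ p d h
    exact h.card_filter_eq_four_of_even hr hodd hz0 hz
  refine ⟨⟨?_, fun h => ?_⟩, hcount⟩
  · rintro ⟨p, d, h, i, hi⟩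
    by_contra hnot
    exact h.ne_four_of_not hr hn hnot i hi
  · obtain ⟨p, d, hd⟩ := exists_isBlockForm n r
    have hcard := hcount h p d hd
    have hr3 : 0 < (r - 1) / 2 := by
      obtain ⟨m, hm⟩ := h.1
      have := hr.two_le
      omega
    rw [← hcard, Finset.card_pos] at hr3
    obtain ⟨i, hi⟩ := hr3
    exact ⟨p, d, hd, i, (Finset.mem_filter.1 hi).2⟩
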